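/- Let A generate a bounded C₀-group {U(t)} (‖U(t)‖ ≤ M̃ for all t) satisfying the non-quasianalyticity condition. Then for every k ∈ ℕ there is m_k > 0 such that for all x ∈ X and all r > 0 (not only r ≥ 1): E_r(x,A) ≤ m_k · ω̃_k(1/r, x, A). -/

import Mathlib

open Filter Topology MeasureTheory

variable {X : Type*} [NormedAddCommGroup X] [NormedSpace ℝ X] [CompleteSpace X]

/-- `M_U(t) = sup_{|τ| ≤ t} ‖U(τ)‖`. -/
noncomputable def groupBound (U : ℝ → X →L[ℝ] X) (t : ℝ) : ℝ :=
  sSup {a : ℝ | ∃ τ : ℝ, |τ| ≤ t ∧ a = ‖U τ‖}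

/-- `ω_k(t,x) = sup_{0 ≤ τ ≤ t} ‖(U(τ)-I)^k x‖`, the k-th modulus of continuity. -/
noncomputable def modulus (U : ℝ → X →L[ℝ] X) (k : ℕ) (t : ℝ) (x : X) : ℝ :=
  sSup {a : ℝ | ∃ τ : ℝ, 0 ≤ τ ∧ τ ≤ t ∧ a = ‖((U τ - 1) ^ k) x‖}

/-- `ω̃_k(t,x) = sup_{|τ| ≤ t} ‖(U(τ)-I)^k x‖`, the symmetric modulus of continuity. -/
noncomputable def symModulus (U : ℝ → X →L[ℝ] X) (k : ℕ) (t : ℝ) (x : X) : ℝ :=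
  sSup {a : ℝ | ∃ τ : ℝ, |τ| ≤ t ∧ a = ‖((U τ - 1) ^ k) x‖}

/-- `U` is a `C₀`-group of bounded operators. -/
structure IsC0Group (U : ℝ → X →L[ℝ] X) : Prop where
  map_zero : U 0 = 1
  map_add : ∀ s t : ℝ, U (s + t) = U s ∘L U t
  cont : ∀ x : X, Continuous fun t : ℝ => U t x

/-- The chain relation `A (xs n) = xs (n+1)` for the generator `A` of the group `U`,
expressed via `d/ds U(s) xs n = U(s) (xs (n+1))`. -/
def GenChain (U : ℝ → X →L[ℝ] X) (xs : ℕ → X) : Prop :=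
  ∀ (n : ℕ) (s : ℝ), HasDerivAt (fun t : ℝ => U t (xs n)) (U s (xs (n + 1))) s

/-- `y` is an entire vector of exponential type ≤ r for the generator of `U`:
`σ(y,A) = limsup ‖Aⁿy‖^{1/n} ≤ r`. -/
def ExpTypeLe (U : ℝ → X →L[ℝ] X) (y : X) (r : ℝ) : Prop :=
  ∃ xs : ℕ → X, xs 0 = y ∧ GenChain U xs ∧
    ∀ ρ : ℝ, r < ρ → ∃ c : ℝ, 0 < c ∧ ∀ n : ℕ, ‖xs n‖ ≤ c * ρ ^ n

/-- `E_r(x,A)`: the best approximation of `x` by exponential type entire vectors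
of type at most `r`. -/
noncomputable def bestApprox (U : ℝ → X →L[ℝ] X) (x : X) (r : ℝ) : ℝ :=
  sInf {d : ℝ | ∃ y : X, ExpTypeLe U y r ∧ d = ‖x - y‖}

open scoped SchwartzMap FourierTransform in
/-- The Fourier transform of a Schwartz function supported in the unit interval, and all its
derivatives, decay quadratically with constants of exponential growth rate `2π`. -/
lemma SchwartzMap.exists_iteratedDeriv_fourier_le (f : 𝓢(ℝ, ℂ))
    (hf : tsupport f ⊆ Metric.closedBall 0 1) :
    ∃ C : ℝ, ∀ (n : ℕ) (t : ℝ),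
      (1 + t ^ 2) * ‖iteratedDeriv n (𝓕 (f : ℝ → ℂ)) t‖ ≤ C * ((n + 1 : ℝ) ^ 3 * (2 * Real.pi) ^ n) := by
  set D : ℝ := ∑ p ∈ Finset.range 3, ∫ v, ‖iteratedFDeriv ℝ p f v‖ with hD
  have hI (p : ℕ) : 0 ≤ ∫ v, ‖iteratedFDeriv ℝ p f v‖ := by positivity
  have hint (p : ℕ) : Integrable (fun v => ‖iteratedFDeriv ℝ p f v‖) := by
    simpa using f.integrable_pow_mul_iteratedFDeriv volume 0 p
  have hmom (i p : ℕ) : ∫ v, ‖v‖ ^ i * ‖iteratedFDeriv ℝ p f v‖ ≤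
      ∫ v, ‖iteratedFDeriv ℝ p f v‖ := by
    refine integral_mono (f.integrable_pow_mul_iteratedFDeriv volume i p) (hint p) fun v => ?_
    by_cases hv : v ∈ tsupport f
    · have h1 : ‖v‖ ≤ 1 := by simpa using hf hv
      exact mul_le_of_le_one_left (norm_nonneg _) (pow_le_one₀ (norm_nonneg _) h1)
    · have h0 : iteratedFDeriv ℝ p f v = 0 := by
        by_contra h
        exact hv (support_iteratedFDeriv_subset (𝕜 := ℝ) p h)
      simp [h0]
  have key (n m : ℕ) (hm : m ≤ 2) (t : ℝ) : ‖t‖ ^ m * ‖iteratedDeriv n (𝓕 (f : ℝ → ℂ)) t‖ ≤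
      (2 * Real.pi) ^ n * (2 * n + 2) ^ m * ((n + 1) * D) := by
    have h := Real.pow_mul_norm_iteratedFDeriv_fourier_le (K := ⊤) (N := ⊤) (f.smooth ⊤)
      (fun k n _ _ => f.integrable_pow_mul_iteratedFDeriv volume k n)
      (k := n) (n := m) le_top le_top t
    rw [norm_iteratedFDeriv_eq_norm_iteratedDeriv] at h
    refine h.trans ?_
    gcongr
    rw [Finset.sum_product]
    calc _ ≤ ∑ _i ∈ Finset.range (n + 1), D := by
          refine Finset.sum_le_sum fun i _ => ?_
          refine (Finset.sum_le_sum fun p _ => hmom i p).trans ?_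
          exact Finset.sum_le_sum_of_subset_of_nonneg
            (Finset.range_mono (by omega)) fun p _ _ => hI p
      _ = (n + 1) * D := by simp
  refine ⟨5 * D, fun n t => ?_⟩
  have h0 := key n 0 (by omega) t
  have h2 := key n 2 le_rfl t
  have hDn : 0 ≤ D := Finset.sum_nonneg fun p _ => hI p
  have hP : 0 ≤ (2 * Real.pi) ^ n * D := by positivity
  rw [Real.norm_eq_abs, sq_abs] at h2
  have hn : (n + 1 : ℝ) ≤ (n + 1) ^ 3 := by
    exact le_self_pow₀ (by linarith [n.cast_nonneg (α := ℝ)]) (by norm_num)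
  nlinarith [mul_le_mul_of_nonneg_left hn hP]

open scoped SchwartzMap FourierTransform in
/-- A real integrable kernel of mean one and exponential type `2π`, with all moments finite.
`K n` is the `n`-th derivative of `K 0`. -/
lemma exists_expType_kernel : ∃ (K : ℕ → ℝ → ℝ) (C : ℝ),
    (∀ n t, HasDerivAt (K n) (K (n + 1) t) t) ∧
    (∀ n t, (1 + t ^ 2) * |K n t| ≤ C * ((n + 1 : ℝ) ^ 3 * (2 * Real.pi) ^ n)) ∧
    (∀ k : ℕ, Integrable fun t => |t| ^ k * |K 0 t|) ∧ ∫ t, K 0 t = 1 := by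
  let b : ContDiffBump (0 : ℝ) := ⟨1 / 2, 1, by norm_num, by norm_num⟩
  have hsupp : tsupport (fun x => (b x : ℂ)) ⊆ Metric.closedBall 0 1 := by
    refine (closure_mono ?_).trans b.tsupport_eq.subset
    intro x hx
    simpa using hx
  have hcomp : HasCompactSupport fun x => (b x : ℂ) :=
    (isCompact_closedBall (0 : ℝ) 1).of_isClosed_subset (isClosed_tsupport _) hsupp
  have hsmooth : ContDiff ℝ (⊤ : ℕ∞) fun x => (b x : ℂ) :=
    Complex.ofRealCLM.contDiff.comp b.contDiff
  let f : 𝓢(ℝ, ℂ) := hcomp.toSchwartzMap hsmooth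
  obtain ⟨C, hC⟩ := f.exists_iteratedDeriv_fourier_le hsupp
  refine ⟨fun n t => (iteratedDeriv n (𝓕 f : 𝓢(ℝ, ℂ)) t).re, C, fun n t => ?_, fun n t => ?_, fun k => ?_, ?_⟩
  · have hd := ((𝓕 f).smooth ⊤).differentiable_iteratedDeriv n
      (by exact_mod_cast WithTop.coe_lt_top _) t
    have h := hd.hasDerivAt
    rw [← iteratedDeriv_succ] at h
    exact Complex.reCLM.hasFDerivAt.comp_hasDerivAt t h
  · refine le_trans ?_ (hC n t)
    gcongr
    exact Complex.abs_re_le_norm _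
  · refine ((𝓕 f).integrable_pow_mul volume k).mono' ?_ (.of_forall fun t => ?_)
    · have : Continuous fun t => |t| ^ k * |((𝓕 f) t).re| :=
        (continuous_abs.pow k).mul (Complex.continuous_re.comp (𝓕 f).continuous).abs
      simpa using this.aestronglyMeasurable
    · simp only [iteratedDeriv_zero, norm_mul, norm_pow, Real.norm_eq_abs, abs_abs]
      gcongr
      exact Complex.abs_re_le_norm _
  · have h1 : ∫ t, (𝓕 f) t = 1 := by
      have h : (𝓕⁻ (𝓕 f : 𝓢(ℝ, ℂ)) : 𝓢(ℝ, ℂ)) 0 = f 0 := by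
        rw [FourierTransform.fourierInv_fourier_eq]
      have hf0 : f 0 = 1 := by
        change ((b 0 : ℝ) : ℂ) = 1
        rw [b.one_of_mem_closedBall (by simp [b.rIn_pos.le])]
        simp
      rw [hf0, SchwartzMap.fourierInv_coe, Real.fourierInv_eq] at h
      simpa using h
    have h2 := integral_re (𝕜 := ℂ) ((𝓕 f).integrable (μ := volume))
    simpa [h1] using h2

set_option linter.unusedSectionVars false

/-- A continuous bounded function times a kernel of quadratic decay is integrable. -/
lemma integrable_kernel_smul {K : ℝ → ℝ} {C B : ℝ} {g : ℝ → X} (hK : Continuous K)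
    (hC : ∀ t, (1 + t ^ 2) * |K t| ≤ C) (hg : Continuous g) (hB : ∀ t, ‖g t‖ ≤ B) :
    Integrable fun t => K t • g t := by
  refine (integrable_inv_one_add_sq.const_mul (C * B)).mono'
    (hK.smul hg).aestronglyMeasurable (.of_forall fun t => ?_)
  have h1 : |K t| ≤ C * (1 + t ^ 2)⁻¹ := by
    rw [← div_eq_mul_inv, le_div_iff₀ (by positivity), mul_comm]
    exact hC t
  calc ‖K t • g t‖ = |K t| * ‖g t‖ := norm_smul _ _
    _ ≤ (C * (1 + t ^ 2)⁻¹) * B :=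
        mul_le_mul h1 (hB t) (norm_nonneg _) ((abs_nonneg _).trans h1)
    _ = C * B * (1 + t ^ 2)⁻¹ := by ring

/-- Differentiation of a convolution integral in its translation parameter. -/
lemma hasDerivAt_integral_translate_smul {K K' : ℝ → ℝ} {C C' B : ℝ} {g : ℝ → X}
    (hK : ∀ t, HasDerivAt K (K' t) t) (hK' : Continuous K')
    (hC : ∀ t, (1 + t ^ 2) * |K t| ≤ C) (hC' : ∀ t, (1 + t ^ 2) * |K' t| ≤ C')
    (hg : Continuous g) (hB : ∀ t, ‖g t‖ ≤ B) (s : ℝ) :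
    HasDerivAt (fun s => ∫ t, K (t - s) • g t) (-∫ t, K' (t - s) • g t) s := by
  have hKc : Continuous K := continuous_iff_continuousAt.2 fun t => (hK t).continuousAt
  have hB0 : 0 ≤ B := (norm_nonneg _).trans (hB 0)
  have hshift (s : ℝ) : Continuous fun t : ℝ => t - s := by fun_prop
  have hmeas (s : ℝ) : AEStronglyMeasurable (fun t => K (t - s) • g t) :=
    ((hKc.comp (hshift s)).smul hg).aestronglyMeasurable
  have hint : Integrable fun t => K (t - s) • g t := by
    have h := (integrable_kernel_smul hKc hC (hg.comp (continuous_add_const s))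
      fun t => hB (t + s)).comp_sub_right s
    simpa using h
  have h := hasDerivAt_integral_of_dominated_loc_of_deriv_le (μ := volume)
    (F := fun s t => K (t - s) • g t) (F' := fun s t => (-K' (t - s)) • g t)
    (bound := fun t => 3 * C' * B * (1 + (t - s) ^ 2)⁻¹)
    (Metric.ball_mem_nhds s one_pos) (.of_forall hmeas) hint
    ((hK'.comp (hshift s)).neg.smul hg).aestronglyMeasurable
    (.of_forall fun t u hu => ?_)
    ((integrable_inv_one_add_sq.comp_sub_right s).const_mul (3 * C' * B))
    (.of_forall fun t u _ => ?_)
  · simpa [neg_smul, integral_neg] using h.2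
  · have hsu : (u - s) ^ 2 ≤ 1 := by
      rw [Metric.mem_ball, Real.dist_eq] at hu
      rw [sq_le_one_iff_abs_le_one]
      exact hu.le
    have h1 : |K' (t - u)| ≤ 3 * C' * (1 + (t - s) ^ 2)⁻¹ := by
      rw [← div_eq_mul_inv, le_div_iff₀ (by positivity)]
      have h2 : 1 + (t - s) ^ 2 ≤ 3 * (1 + (t - u) ^ 2) := by
        nlinarith [sq_nonneg ((t - u) - (u - s)), sq_nonneg (t - u)]
      nlinarith [hC' (t - u), abs_nonneg (K' (t - u)),
        mul_le_mul_of_nonneg_left h2 (abs_nonneg (K' (t - u)))]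
    calc ‖(-K' (t - u)) • g t‖ = |K' (t - u)| * ‖g t‖ := by simp [norm_smul]
      _ ≤ (3 * C' * (1 + (t - s) ^ 2)⁻¹) * B :=
          mul_le_mul h1 (hB t) (norm_nonneg _) ((abs_nonneg _).trans h1)
      _ = 3 * C' * B * (1 + (t - s) ^ 2)⁻¹ := by ring
  · have h3 : HasDerivAt (fun u : ℝ => K (t - u)) (-K' (t - u)) u := by
      simpa using (hK (t - u)).comp_const_sub t u
    exact h3.smul_const (g t)

lemma ExpTypeLe.zero (U : ℝ → X →L[ℝ] X) (r : ℝ) (hr : 0 ≤ r) : ExpTypeLe U 0 r := by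
  refine ⟨fun _ => 0, rfl, fun n s => by simpa using hasDerivAt_const s (0 : X), fun ρ hρ => ?_⟩
  exact ⟨1, one_pos, fun n => by simpa using pow_nonneg (hr.trans hρ.le) n⟩

lemma ExpTypeLe.add {U : ℝ → X →L[ℝ] X} {y z : X} {r : ℝ} (hy : ExpTypeLe U y r)
    (hz : ExpTypeLe U z r) : ExpTypeLe U (y + z) r := by
  obtain ⟨ys, rfl, hys, hyb⟩ := hy
  obtain ⟨zs, rfl, hzs, hzb⟩ := hz
  refine ⟨fun n => ys n + zs n, rfl, fun n s => ?_, fun ρ hρ => ?_⟩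
  · simpa using (hys n s).fun_add (hzs n s)
  · obtain ⟨c, hc, hcb⟩ := hyb ρ hρ
    obtain ⟨d, hd, hdb⟩ := hzb ρ hρ
    refine ⟨c + d, add_pos hc hd, fun n => (norm_add_le _ _).trans ?_⟩
    rw [add_mul]
    exact add_le_add (hcb n) (hdb n)

lemma ExpTypeLe.const_smul {U : ℝ → X →L[ℝ] X} {y : X} {r : ℝ} (hy : ExpTypeLe U y r)
    (a : ℝ) (hr : 0 ≤ r) : ExpTypeLe U (a • y) r := by
  obtain ⟨ys, rfl, hys, hyb⟩ := hy
  refine ⟨fun n => a • ys n, rfl, fun n s => ?_, fun ρ hρ => ?_⟩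
  · simpa using (hys n s).fun_const_smul a
  · obtain ⟨c, hc, hcb⟩ := hyb ρ hρ
    refine ⟨(|a| + 1) * c, by positivity, fun n => ?_⟩
    have hρ0 : 0 ≤ ρ := hr.trans hρ.le
    rw [norm_smul, Real.norm_eq_abs, mul_assoc]
    exact mul_le_mul (by linarith) (hcb n) (norm_nonneg _) (by positivity)

lemma ExpTypeLe.mono {U : ℝ → X →L[ℝ] X} {y : X} {r r' : ℝ} (hy : ExpTypeLe U y r)
    (h : r ≤ r') : ExpTypeLe U y r' := by
  obtain ⟨ys, h0, hys, hyb⟩ := hy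
  exact ⟨ys, h0, hys, fun ρ hρ => hyb ρ (h.trans_lt hρ)⟩

lemma ExpTypeLe.sum {ι : Type*} {U : ℝ → X →L[ℝ] X} {r : ℝ} (hr : 0 ≤ r) (s : Finset ι)
    (y : ι → X) (hy : ∀ i ∈ s, ExpTypeLe U (y i) r) : ExpTypeLe U (∑ i ∈ s, y i) r :=
  Finset.sum_induction y (ExpTypeLe U · r) (fun _ _ => ExpTypeLe.add) (.zero U r hr) hy

/-- Polynomial factors are absorbed by a slightly larger exponential rate. -/
lemma exists_succ_pow_mul_pow_le {r ρ : ℝ} (hr : 0 < r) (h : r < ρ) (p : ℕ) :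
    ∃ c : ℝ, 0 < c ∧ ∀ n : ℕ, (n + 1 : ℝ) ^ p * r ^ n ≤ c * ρ ^ n := by
  have hρ : 0 < ρ := hr.trans h
  have hq : 0 < r / ρ := by positivity
  have ht := tendsto_pow_const_mul_const_pow_of_lt_one p hq.le ((div_lt_one hρ).2 h)
  obtain ⟨c, hc⟩ := ht.bddAbove_range
  refine ⟨(|c| + 1) / (r / ρ), by positivity, fun n => ?_⟩
  have h1 : ((n + 1 : ℕ) : ℝ) ^ p * (r / ρ) ^ (n + 1) ≤ c := hc ⟨n + 1, rfl⟩
  have h2 : (n + 1 : ℝ) ^ p * (r / ρ) ^ n ≤ (|c| + 1) / (r / ρ) := by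
    rw [le_div_iff₀ hq, mul_assoc, ← pow_succ]
    push_cast at h1
    linarith [le_abs_self c]
  calc (n + 1 : ℝ) ^ p * r ^ n = (n + 1 : ℝ) ^ p * (r / ρ) ^ n * ρ ^ n := by
        rw [mul_assoc, ← mul_pow, div_mul_cancel₀ _ hρ.ne']
    _ ≤ _ := by gcongr

/-- Averaging the orbit of `x` against a kernel of exponential type `σ` produces a vector of
exponential type `σ / h`, where `h` is the time scale. -/
lemma expTypeLe_integral_kernel {U : ℝ → X →L[ℝ] X} (hU : IsC0Group U) {M : ℝ}
    (hM : ∀ t : ℝ, ‖U t‖ ≤ M) {K : ℕ → ℝ → ℝ} {C σ : ℝ} (hσ : 0 < σ)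
    (hK : ∀ n t, HasDerivAt (K n) (K (n + 1) t) t)
    (hC : ∀ n t, (1 + t ^ 2) * |K n t| ≤ C * ((n + 1 : ℝ) ^ 3 * σ ^ n))
    (x : X) {h : ℝ} (hh : 0 < h) :
    ExpTypeLe U (∫ t, K 0 t • U (h * t) x) (σ / h) := by
  have hKc (n : ℕ) : Continuous (K n) :=
    continuous_iff_continuousAt.2 fun t => (hK n t).continuousAt
  have hg : Continuous fun t => U (h * t) x := (hU.cont x).comp (continuous_const_mul h)
  have hB (t : ℝ) : ‖U (h * t) x‖ ≤ M * ‖x‖ := (U (h * t)).le_of_opNorm_le (hM _) x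
  have hint (n : ℕ) : Integrable fun t => K n t • U (h * t) x :=
    integrable_kernel_smul (hKc n) (hC n) hg hB
  have horbit (n : ℕ) (s : ℝ) :
      U s (∫ t, K n t • U (h * t) x) = ∫ t, K n (t - s / h) • U (h * t) x := by
    rw [← (U s).integral_comp_comm (hint n),
      ← integral_sub_right_eq_self (fun t => U s (K n t • U (h * t) x)) (s / h)]
    refine integral_congr_ae (.of_forall fun t => ?_)
    have : h * t = s + h * (t - s / h) := by field_simp; ring
    simp only [map_smul]
    rw [this, hU.map_add]
    simp
  refine ⟨fun n => (-1 / h) ^ n • ∫ t, K n t • U (h * t) x, by simp, fun n s => ?_,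
    fun ρ hρ => ?_⟩
  · simp only [map_smul, horbit]
    have hd := hasDerivAt_integral_translate_smul (hK n) (hKc (n + 1)) (hC n) (hC (n + 1)) hg hB
      (s / h)
    have hd' := (hd.scomp s ((hasDerivAt_id s).div_const h)).const_smul ((-1 / h) ^ n)
    refine hd'.congr_deriv ?_
    rw [smul_smul, smul_neg, ← neg_smul]
    congr 1
    ring
  · obtain ⟨c, hc, hcb⟩ := exists_succ_pow_mul_pow_le (div_pos hσ hh) hρ 3
    have hρ0 : 0 < ρ := (div_pos hσ hh).trans hρ
    have hM0 : 0 ≤ M := (norm_nonneg _).trans (hM 0)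
    have hC0 : 0 ≤ C := by
      have := hC 0 0
      simp only [Nat.cast_zero, zero_add, one_pow, pow_zero, mul_one] at this
      exact le_trans (by positivity) this
    refine ⟨(C * (M * ‖x‖) * Real.pi + 1) * c, by positivity, fun n => ?_⟩
    have hI : ‖∫ t, K n t • U (h * t) x‖ ≤
        C * ((n + 1 : ℝ) ^ 3 * σ ^ n) * (M * ‖x‖) * Real.pi := by
      rw [← integral_univ_inv_one_add_sq, ← integral_const_mul]
      refine norm_integral_le_of_norm_le (integrable_inv_one_add_sq.const_mul _)
        (.of_forall fun t => ?_)
      rw [norm_smul, Real.norm_eq_abs]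
      have h1 : |K n t| ≤ C * ((n + 1 : ℝ) ^ 3 * σ ^ n) * (1 + t ^ 2)⁻¹ := by
        rw [← div_eq_mul_inv, le_div_iff₀ (by positivity), mul_comm]
        exact hC n t
      calc _ ≤ (C * ((n + 1 : ℝ) ^ 3 * σ ^ n) * (1 + t ^ 2)⁻¹) * (M * ‖x‖) :=
            mul_le_mul h1 (hB t) (norm_nonneg _) (by positivity)
        _ = _ := by ring
    have hnorm : ‖(-1 / h) ^ n‖ = (1 / h) ^ n := by
      simp [abs_of_pos hh]
    rw [norm_smul, hnorm]
    calc (1 / h) ^ n * ‖∫ t, K n t • U (h * t) x‖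
        ≤ (1 / h) ^ n * (C * ((n + 1 : ℝ) ^ 3 * σ ^ n) * (M * ‖x‖) * Real.pi) := by gcongr
      _ = (C * (M * ‖x‖) * Real.pi) * ((n + 1 : ℝ) ^ 3 * (σ / h) ^ n) := by
          rw [div_pow, div_pow, one_pow]; ring
      _ ≤ (C * (M * ‖x‖) * Real.pi + 1) * (c * ρ ^ n) :=
          mul_le_mul (by linarith) (hcb n) (by positivity) (by positivity)
      _ = _ := by ring

lemma IsC0Group.map_nat_mul {U : ℝ → X →L[ℝ] X} (hU : IsC0Group U) (n : ℕ) (t : ℝ) :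
    U (n * t) = U t ^ n := by
  induction n with
  | zero => simpa using hU.map_zero
  | succ n ih =>
    rw [Nat.cast_succ, add_mul, one_mul, hU.map_add, ih, pow_succ]
    rfl

lemma norm_le_symModulus {U : ℝ → X →L[ℝ] X} {M : ℝ} (hM : ∀ t : ℝ, ‖U t‖ ≤ M) (k : ℕ)
    {t τ : ℝ} (h : |τ| ≤ t) (x : X) : ‖((U τ - 1) ^ k) x‖ ≤ symModulus U k t x := by
  refine le_csSup ⟨(M + 1) ^ k * ‖x‖, ?_⟩ ⟨τ, h, rfl⟩
  rintro _ ⟨s, -, rfl⟩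
  have h1 : ‖(1 : X →L[ℝ] X)‖ ≤ 1 := ContinuousLinearMap.norm_id_le
  have h2 : ‖U s - 1‖ ≤ M + 1 := (norm_sub_le _ _).trans (add_le_add (hM s) h1)
  have h3 (y : X) : ‖((U s - 1) ^ k) y‖ ≤ (M + 1) ^ k * ‖y‖ := by
    have hM0 : 0 ≤ M + 1 := (norm_nonneg _).trans h2
    induction k with
    | zero => simp
    | succ k ih =>
      rw [pow_succ', mul_apply_eq_comp, pow_succ', mul_assoc]
      exact ((U s - 1).le_of_opNorm_le h2 _).trans (by gcongr)
  exact h3 x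

lemma norm_sub_one_pow_nat_mul_le {U : ℝ → X →L[ℝ] X} (hU : IsC0Group U) {M : ℝ}
    (hM : ∀ t : ℝ, ‖U t‖ ≤ M) (k n : ℕ) (τ : ℝ) (x : X) :
    ‖((U (n * τ) - 1) ^ k) x‖ ≤ (n * M) ^ k * ‖((U τ - 1) ^ k) x‖ := by
  set S : X →L[ℝ] X := ∑ i ∈ Finset.range n, U τ ^ i with hS
  have hM0 : 0 ≤ M := (norm_nonneg _).trans (hM 0)
  have hSn : ‖S‖ ≤ n * M := by
    refine (norm_sum_le_of_le (Finset.range n) (f := fun i => U τ ^ i) (n := fun _ => M)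
      fun i _ => ?_).trans ?_
    · rw [← hU.map_nat_mul]
      exact hM _
    · simp
  have hcomm : Commute S (U τ - 1) :=
    (Commute.sum_left _ _ _ fun i _ => (Commute.refl (U τ)).pow_left i).sub_right
      (Commute.one_right _)
  have hpow (j : ℕ) (y : X) : ‖(S ^ j) y‖ ≤ (n * M) ^ j * ‖y‖ := by
    induction j with
    | zero => simp
    | succ j ih =>
      rw [pow_succ', mul_apply_eq_comp, pow_succ', mul_assoc]
      exact (S.le_of_opNorm_le hSn _).trans (by gcongr)
  rw [hU.map_nat_mul, ← geom_sum_mul, ← hS, hcomm.mul_pow, mul_apply_eq_comp]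
  exact hpow k _

/-- The `k`-th differences grow at most like the `k`-th power of the step length. -/
lemma norm_sub_one_pow_le_symModulus {U : ℝ → X →L[ℝ] X} (hU : IsC0Group U) {M : ℝ}
    (hM : ∀ t : ℝ, ‖U t‖ ≤ M) (k : ℕ) {τ : ℝ} (hτ : 0 < τ) (s : ℝ) (x : X) :
    ‖((U s - 1) ^ k) x‖ ≤ ((|s| / τ + 1) * M) ^ k * symModulus U k τ x := by
  have hM0 : 0 ≤ M := (norm_nonneg _).trans (hM 0)
  set n : ℕ := ⌊|s| / τ⌋₊ + 1 with hn
  have hn0 : (0 : ℝ) < n := by positivity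
  have hle : (n : ℝ) ≤ |s| / τ + 1 := by
    rw [hn]; push_cast
    gcongr
    exact Nat.floor_le (by positivity)
  have hlt : |s| / τ ≤ n := by
    rw [hn]; push_cast
    exact (Nat.lt_floor_add_one _).le
  have habs : |s / n| ≤ τ := by
    rw [abs_div, abs_of_pos hn0, div_le_iff₀ hn0, mul_comm]
    exact (div_le_iff₀ hτ).1 hlt
  have h := norm_sub_one_pow_nat_mul_le hU hM k n (s / n) x
  rw [mul_div_cancel₀ s hn0.ne'] at h
  refine h.trans ?_
  have h2 := norm_le_symModulus hM k habs x
  gcongr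

lemma one_sub_pow_apply {U : ℝ → X →L[ℝ] X} (hU : IsC0Group U) (k : ℕ) (τ : ℝ) (x : X) :
    ((1 - U τ) ^ k) x = x + ∑ m ∈ Finset.range k,
      ((-1 : ℝ) ^ (m + 1) * (k.choose (m + 1) : ℝ)) • U ((m + 1 : ℕ) * τ) x := by
  have h1 : (1 - U τ) ^ k = ∑ m ∈ Finset.range (k + 1),
      ((-1 : ℝ) ^ m * (k.choose m : ℝ)) • U (m * τ) := by
    rw [sub_eq_neg_add, (Commute.one_right (-U τ)).add_pow]
    refine Finset.sum_congr rfl fun m _ => ?_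
    rw [hU.map_nat_mul, one_pow, mul_one, neg_pow, mul_smul, ← Nat.cast_comm,
      Nat.cast_smul_eq_nsmul, nsmul_eq_mul]
    rcases m.even_or_odd with he | he <;> simp [he.neg_one_pow]
  rw [h1, Finset.sum_range_succ']
  simp [hU.map_zero, add_comm x]

lemma bestApprox_le {U : ℝ → X →L[ℝ] X} {x y : X} {r : ℝ} (hy : ExpTypeLe U y r) :
    bestApprox U x r ≤ ‖x - y‖ := by
  refine csInf_le ⟨0, ?_⟩ ⟨y, hy, rfl⟩
  rintro _ ⟨z, -, rfl⟩
  exact norm_nonneg _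

/-- Jackson inequality for bounded groups: if moreover ‖U(t)‖ ≤ M̃ for all t,
then for every k ∈ ℕ there is m_k > 0 with
E_r(x,A) ≤ m_k · ω̃_k(1/r, x, A) for all x ∈ X and all r > 0. -/
theorem stmt_18 {X : Type*} [NormedAddCommGroup X] [NormedSpace ℝ X] [CompleteSpace X]
    (U : ℝ → X →L[ℝ] X) (hU : IsC0Group U)
    (hqa : Integrable (fun t : ℝ => Real.log ‖U t‖ / (1 + t ^ 2)))
    (M : ℝ) (hM : ∀ t : ℝ, ‖U t‖ ≤ M) :
    ∀ k : ℕ, 1 ≤ k → ∃ m : ℝ, 0 < m ∧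
      ∀ (x : X) (r : ℝ), 0 < r →
        bestApprox U x r ≤ m * symModulus U k (1 / r) x := by
  intro k _
  have hM0 : 0 ≤ M := (norm_nonneg _).trans (hM 0)
  obtain ⟨K, C, hK, hC, hmom, hmean⟩ := exists_expType_kernel
  have hKc : Continuous (K 0) := continuous_iff_continuousAt.2 fun t => (hK 0 t).continuousAt
  have hKint : Integrable (K 0) := by
    rw [← integrable_norm_iff hKc.aestronglyMeasurable]
    simpa using hmom 0
  have hweight : Integrable fun t => |K 0 t| * (2 * Real.pi * |t| + 1) ^ k := by
    simp only [add_pow, Finset.mul_sum]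
    refine integrable_finsetSum _ fun i _ => ?_
    refine ((hmom i).const_mul ((2 * Real.pi) ^ i * (k.choose i : ℝ))).congr
      (.of_forall fun t => ?_)
    simp only [mul_pow, one_pow]
    ring
  set I : ℝ := ∫ t, |K 0 t| * (2 * Real.pi * |t| + 1) ^ k with hI
  have hI0 : 0 ≤ I := integral_nonneg fun t => by positivity
  refine ⟨I * M ^ k + 1, by positivity, fun x r hr => ?_⟩
  have hω : 0 ≤ symModulus U k (1 / r) x :=
    (norm_nonneg _).trans (norm_le_symModulus hM k (τ := 0) (by simp [hr.le]) x)
  set h : ℝ := 2 * Real.pi / r with hh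
  have hh0 : 0 < h := by positivity
  let a : ℕ → ℝ := fun m => (-1 : ℝ) ^ (m + 1) * (k.choose (m + 1) : ℝ)
  let Y : ℕ → X := fun m => ∫ t, K 0 t • U ((m + 1 : ℕ) * h * t) x
  have hY (m : ℕ) : ExpTypeLe U (Y m) r := by
    have hm : (1 : ℝ) ≤ (m + 1 : ℕ) := by simp
    refine (expTypeLe_integral_kernel hU hM Real.two_pi_pos hK hC x
      (h := (m + 1 : ℕ) * h) (by positivity)).mono ?_
    rw [div_le_iff₀ (by positivity)]
    have : r * ((m + 1 : ℕ) * h) = (m + 1 : ℕ) * (2 * Real.pi) := by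
      rw [hh]; field_simp
    rw [this]
    exact le_mul_of_one_le_left Real.two_pi_pos.le hm
  have hy : ExpTypeLe U (-∑ m ∈ Finset.range k, a m • Y m) r := by
    rw [← neg_one_smul ℝ]
    exact (ExpTypeLe.sum hr.le _ _ fun m _ => (hY m).const_smul (a m) hr.le).const_smul _ hr.le
  have hdiff : x - -∑ m ∈ Finset.range k, a m • Y m =
      ∫ t, K 0 t • ((1 - U (h * t)) ^ k) x := by
    have hterm (m : ℕ) : Integrable fun t => K 0 t • U ((m + 1 : ℕ) * h * t) x :=
      integrable_kernel_smul hKc (hC 0) ((hU.cont x).comp (continuous_const_mul _))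
        fun t => (U _).le_of_opNorm_le (hM _) x
    have hpt (t : ℝ) : K 0 t • ((1 - U (h * t)) ^ k) x =
        K 0 t • x + ∑ m ∈ Finset.range k, a m • K 0 t • U ((m + 1 : ℕ) * h * t) x := by
      rw [one_sub_pow_apply hU, smul_add, Finset.smul_sum]
      congr 1
      refine Finset.sum_congr rfl fun m _ => ?_
      rw [smul_comm, mul_assoc]
    have hsmul (m : ℕ) : Integrable fun t => a m • K 0 t • U ((m + 1 : ℕ) * h * t) x :=
      (hterm m).smul (a m)
    simp only [hpt]
    rw [integral_add (hKint.smul_const x)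
      (integrable_finsetSum _ fun m _ => hsmul m),
      integral_smul_const, hmean, one_smul, sub_neg_eq_add,
      integral_finsetSum _ fun m _ => hsmul m]
    simp only [integral_smul, Y]
  refine (bestApprox_le hy).trans ?_
  rw [hdiff]
  have hbound : ‖∫ t, K 0 t • ((1 - U (h * t)) ^ k) x‖ ≤
      I * (M ^ k * symModulus U k (1 / r) x) := by
    rw [hI, ← integral_mul_const]
    refine norm_integral_le_of_norm_le (hweight.mul_const _) (.of_forall fun t => ?_)
    have hsign : ‖((1 - U (h * t)) ^ k) x‖ = ‖((U (h * t) - 1) ^ k) x‖ := by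
      rw [← neg_sub, neg_pow]
      rcases neg_one_pow_eq_or (X →L[ℝ] X) k with hk | hk <;> simp [hk]
    have hstep := norm_sub_one_pow_le_symModulus hU hM k (one_div_pos.2 hr) (h * t) x
    have hlen : |h * t| / (1 / r) = 2 * Real.pi * |t| := by
      rw [abs_mul, abs_of_pos hh0, hh]; field_simp
    rw [hlen] at hstep
    rw [norm_smul, Real.norm_eq_abs, hsign, mul_assoc]
    refine mul_le_mul_of_nonneg_left (hstep.trans_eq ?_) (abs_nonneg _)
    rw [mul_pow, mul_assoc]
  nlinarith [hbound]
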